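/- Let q be a prime power and let N, k, m be integers with 1 ≤ k ≤ N and 1 ≤ m ≤ N−k, and let A, A' be m-dimensional F_q-subspaces of F_q^N with A ∩ A' = {0}. For integers 1 ≤ ℓ ≤ m and 1 ≤ ℓ' ≤ m, the number of k-dimensional F_q-subspaces U of F_q^N with dim_{F_q}(U ∩ A) = ℓ and dim_{F_q}(U ∩ A') = ℓ' equals [m choose ℓ]_q [m choose ℓ']_q Σ_{r=ℓ}^{m} Σ_{s=ℓ'}^{m} [m−ℓ choose r−ℓ]_q [m−ℓ' choose s−ℓ']_q [N−r−s choose k−r−s]_q (−1)^{r+s−ℓ−ℓ'} q^{(r−ℓ)(r−ℓ−1)/2+(s−ℓ')(s−ℓ'−1)/2}. Consequently, for an integer 1 ≤ h ≤ m−1, the number of k-dimensional subspaces U with dim_{F_q}(U ∩ A) ≥ h+1 and dim_{F_q}(U ∩ A') ≥ h+1 equals ω_q(N,k,m,h), the sum of the above expression over all ℓ, ℓ' with h+1 ≤ ℓ ≤ m and h+1 ≤ ℓ' ≤ m. -/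

import Mathlib

/-- The Gaussian binomial coefficient `[a choose b]_q`, defined via the `q`-Pascal
recursion; it equals the number of `b`-dimensional `F_q`-subspaces of `F_q^a`. -/
def gaussBinomNat (q : ℕ) : ℕ → ℕ → ℕ
  | _, 0 => 1
  | 0, _ + 1 => 0
  | a + 1, b + 1 => gaussBinomNat q a b + q ^ (b + 1) * gaussBinomNat q a (b + 1)

/-- The Gaussian binomial coefficient with integer indices, with the convention that it
vanishes when `b < 0` or `b > a`. -/
def gaussBinom (q : ℕ) (a b : ℤ) : ℤ :=
  if 0 ≤ b ∧ b ≤ a then gaussBinomNat q a.toNat b.toNat else 0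

/-- The inner double sum of Lemma 5.9: the number of `k`-spaces of `F_q^N` meeting `A`
in dimension `l` and `A'` in dimension `l'` (for disjoint `m`-spaces `A`, `A'`). -/
def doubleCount (q N k m : ℕ) (l l' : ℕ) : ℤ :=
  gaussBinom q m l * gaussBinom q m l' *
    ∑ r ∈ Finset.Icc l m, ∑ s ∈ Finset.Icc l' m,
      gaussBinom q ((m : ℤ) - l) ((r : ℤ) - l) * gaussBinom q ((m : ℤ) - l') ((s : ℤ) - l') *
        gaussBinom q ((N : ℤ) - r - s) ((k : ℤ) - r - s) * (-1) ^ (r + s - l - l') *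
        (q : ℤ) ^ ((r - l) * (r - l - 1) / 2 + (s - l') * (s - l' - 1) / 2)

/-- The quantity `ω_q(N,k,m,h)` of Lemma 5.9. -/
def omegaCount (q N k m h : ℕ) : ℤ :=
  ∑ l ∈ Finset.Icc (h + 1) m, ∑ l' ∈ Finset.Icc (h + 1) m, doubleCount q N k m l l'

theorem gaussBinomNat_zero_right (q n : ℕ) : gaussBinomNat q n 0 = 1 := by
  cases n <;> rfl

theorem gaussBinomNat_succ_succ (q n k : ℕ) :
    gaussBinomNat q (n + 1) (k + 1) =
      gaussBinomNat q n k + q ^ (k + 1) * gaussBinomNat q n (k + 1) := rfl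

theorem gaussBinomNat_eq_zero_of_lt (q : ℕ) {n k : ℕ} (h : n < k) : gaussBinomNat q n k = 0 := by
  induction n generalizing k with
  | zero => obtain ⟨k, rfl⟩ := Nat.exists_eq_succ_of_ne_zero h.ne'; rfl
  | succ n ih =>
    obtain ⟨k, rfl⟩ := Nat.exists_eq_succ_of_ne_zero (Nat.ne_zero_of_lt h)
    rw [Nat.succ_eq_add_one, gaussBinomNat_succ_succ, ih (by omega), ih (by omega)]
    simp

theorem gaussBinomNat_self (q n : ℕ) : gaussBinomNat q n n = 1 := by
  induction n with
  | zero => rfl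
  | succ n ih =>
    rw [gaussBinomNat_succ_succ, ih, gaussBinomNat_eq_zero_of_lt q (Nat.lt_succ_self n)]
    simp

theorem gaussBinom_natCast (q n k : ℕ) : gaussBinom q n k = gaussBinomNat q n k := by
  unfold gaussBinom
  split_ifs with h
  · simp
  · rw [gaussBinomNat_eq_zero_of_lt q (by omega)]
    rfl

/-- The number of ordered bases of a `k`-space times the Gaussian binomial is the number of
linearly independent `k`-tuples in an `n`-space. -/
theorem gaussBinomNat_mul_prod (q n k : ℕ) :
    (gaussBinomNat q n k : ℤ) * ∏ i ∈ Finset.range k, ((q : ℤ) ^ k - (q : ℤ) ^ i) =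
      ∏ i ∈ Finset.range k, ((q : ℤ) ^ n - (q : ℤ) ^ i) := by
  have shift (a b : ℕ) : ∏ i ∈ Finset.range (b + 1), ((q : ℤ) ^ (a + 1) - (q : ℤ) ^ i) =
      ((q : ℤ) ^ (a + 1) - 1) * (q : ℤ) ^ b *
        ∏ i ∈ Finset.range b, ((q : ℤ) ^ a - (q : ℤ) ^ i) := by
    rw [Finset.prod_range_succ', mul_comm, pow_zero, mul_assoc, Finset.prod_congr rfl
      (fun i _ => show (q : ℤ) ^ (a + 1) - (q : ℤ) ^ (i + 1) = q * ((q : ℤ) ^ a - (q : ℤ) ^ i) by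
        ring), Finset.prod_mul_distrib, Finset.prod_const, Finset.card_range]
  induction n generalizing k with
  | zero =>
    cases k with
    | zero => simp [gaussBinomNat_zero_right]
    | succ k =>
      rw [gaussBinomNat_eq_zero_of_lt q (Nat.succ_pos k),
        Finset.prod_range_succ' (fun i => (q : ℤ) ^ 0 - (q : ℤ) ^ i)]
      simp
  | succ n ih =>
    cases k with
    | zero => simp [gaussBinomNat_zero_right]
    | succ k =>
      have h1 := ih (k + 1)
      have h2 := ih k
      rw [Finset.prod_range_succ (fun i => (q : ℤ) ^ n - (q : ℤ) ^ i)] at h1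
      rw [shift n k, ← h2, gaussBinomNat_succ_succ]
      rw [← h2] at h1
      push_cast
      rw [add_mul, mul_assoc, h1, shift k k]
      ring

theorem gaussBinomNat_mul_prod_mul_prod (q a b : ℕ) :
    (gaussBinomNat q (a + b) b : ℤ) * (∏ i ∈ Finset.range a, ((q : ℤ) ^ (i + 1) - 1)) *
      (∏ i ∈ Finset.range b, ((q : ℤ) ^ (i + 1) - 1)) =
      ∏ i ∈ Finset.range (a + b), ((q : ℤ) ^ (i + 1) - 1) := by
  induction a generalizing b with
  | zero => simp [gaussBinomNat_self]
  | succ a iha =>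
    induction b with
    | zero => simp [gaussBinomNat_zero_right]
    | succ b ihb =>
      have h := iha (b + 1)
      rw [show a + (b + 1) = a + 1 + b by ring] at h
      rw [← add_assoc, gaussBinomNat_succ_succ, Finset.prod_range_succ _ (a + 1 + b)]
      push_cast
      rw [Finset.prod_range_succ _ b] at h ⊢
      rw [Finset.prod_range_succ _ a] at ihb ⊢
      linear_combination ((q : ℤ) ^ (b + 1) - 1) * ihb +
        (q : ℤ) ^ (b + 1) * ((q : ℤ) ^ (a + 1) - 1) * h

theorem gaussBinomNat_mul_gaussBinomNat {q : ℕ} (hq : 1 < q) {n r l : ℕ} (hlr : l ≤ r)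
    (hrn : r ≤ n) :
    (gaussBinomNat q n r : ℤ) * gaussBinomNat q r l =
      gaussBinomNat q n l * gaussBinomNat q (n - l) (r - l) := by
  obtain ⟨b, rfl⟩ := Nat.exists_eq_add_of_le' hlr
  obtain ⟨a, rfl⟩ := Nat.exists_eq_add_of_le' hrn
  have hne (m : ℕ) : ∏ i ∈ Finset.range m, ((q : ℤ) ^ (i + 1) - 1) ≠ 0 := by
    refine Finset.prod_ne_zero_iff.mpr fun i _ => ?_
    have : (1 : ℤ) < (q : ℤ) ^ (i + 1) :=
      one_lt_pow₀ (by exact_mod_cast hq) (Nat.succ_ne_zero i)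
    omega
  have h1 := gaussBinomNat_mul_prod_mul_prod q a (b + l)
  have h2 := gaussBinomNat_mul_prod_mul_prod q b l
  have h3 := gaussBinomNat_mul_prod_mul_prod q (a + b) l
  have h4 := gaussBinomNat_mul_prod_mul_prod q a b
  rw [show a + (b + l) - l = a + b by omega, show b + l - l = b by omega]
  rw [add_assoc] at h3
  apply mul_right_cancel₀ (mul_ne_zero (mul_ne_zero (hne a) (hne b)) (hne l))
  rw [← h2, ← h3, ← h4] at h1
  linear_combination h1

/-- Partial alternating sums of a row of Gaussian binomials. -/
theorem sum_range_neg_one_pow_mul_gaussBinomNat (q n M : ℕ) :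
    ∑ j ∈ Finset.range (M + 1),
      (-1) ^ j * (q : ℤ) ^ (j * (j - 1) / 2) * (gaussBinomNat q (n + 1) j : ℤ) =
      (-1) ^ M * (q : ℤ) ^ ((M + 1) * M / 2) * (gaussBinomNat q n M : ℤ) := by
  induction M with
  | zero => simp [gaussBinomNat_zero_right]
  | succ M ih =>
    have h : (M + 1 + 1) * (M + 1) / 2 = (M + 1) * M / 2 + (M + 1) := by
      rw [show (M + 1 + 1) * (M + 1) = (M + 1) * M + (M + 1) * 2 by ring,
        Nat.add_mul_div_right _ _ two_pos]
    rw [Finset.sum_range_succ, ih, gaussBinomNat_succ_succ, h, Nat.add_sub_cancel]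
    push_cast
    ring

theorem sum_range_neg_one_pow_mul_gaussBinomNat_of_le (q : ℕ) {n M : ℕ} (h : n ≤ M) :
    ∑ j ∈ Finset.range (M + 1),
      (-1) ^ j * (q : ℤ) ^ (j * (j - 1) / 2) * (gaussBinomNat q n j : ℤ) =
      if n = 0 then 1 else 0 := by
  cases n with
  | zero =>
    rw [Finset.sum_range_succ', Finset.sum_eq_zero]
    · simp [gaussBinomNat_zero_right]
    · intro j _
      rw [gaussBinomNat_eq_zero_of_lt q (Nat.succ_pos j)]
      simp
  | succ n =>
    rw [sum_range_neg_one_pow_mul_gaussBinomNat, gaussBinomNat_eq_zero_of_lt q h]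
    simp

/-- Inversion for Gaussian binomial coefficients. -/
theorem sum_Icc_gaussBinomNat_inversion {q : ℕ} (hq : 1 < q) {a l m : ℕ} (ha : a ≤ m)
    (hl : l ≤ m) :
    ∑ r ∈ Finset.Icc l m, (-1) ^ (r - l) * (q : ℤ) ^ ((r - l) * (r - l - 1) / 2) *
      ((gaussBinomNat q a r : ℤ) * gaussBinomNat q r l) = if a = l then 1 else 0 := by
  have hterm (r : ℕ) (hr : r ∈ Finset.Icc l m) :
      (-1) ^ (r - l) * (q : ℤ) ^ ((r - l) * (r - l - 1) / 2) *
        ((gaussBinomNat q a r : ℤ) * gaussBinomNat q r l) =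
      gaussBinomNat q a l * ((-1) ^ (r - l) * (q : ℤ) ^ ((r - l) * (r - l - 1) / 2) *
        gaussBinomNat q (a - l) (r - l)) := by
    have hlr := (Finset.mem_Icc.mp hr).1
    rcases le_or_gt r a with h | h
    · rw [gaussBinomNat_mul_gaussBinomNat hq hlr h]
      ring
    · rw [gaussBinomNat_eq_zero_of_lt q h]
      rcases lt_or_ge a l with h' | h'
      · simp [gaussBinomNat_eq_zero_of_lt q h']
      · simp [gaussBinomNat_eq_zero_of_lt q (show a - l < r - l by omega)]
  rw [Finset.sum_congr rfl hterm, ← Finset.mul_sum, ← Finset.Ico_add_one_right_eq_Icc,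
    Finset.sum_Ico_eq_sum_range, show m + 1 - l = m - l + 1 by omega]
  simp only [Nat.add_sub_cancel_left]
  rw [sum_range_neg_one_pow_mul_gaussBinomNat_of_le q (show a - l ≤ m - l by omega)]
  rcases lt_trichotomy a l with h | rfl | h
  · simp [gaussBinomNat_eq_zero_of_lt q h, h.ne]
  · simp [gaussBinomNat_self]
  · rw [if_neg (by omega), if_neg h.ne', mul_zero]

section Counting

variable {F V : Type*} [Field F] [Fintype F] [AddCommGroup V] [Module F V]

/-- Linearly independent families spanning a given subspace `U` of matching dimension are the
linearly independent families in `U`. -/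
noncomputable def linearIndependentSpanEquiv {F V : Type*} [Field F] [AddCommGroup V] [Module F V]
    [FiniteDimensional F V] {k : ℕ} (U : Submodule F V) (hU : Module.finrank F U = k) :
    {s : {s : Fin k → V // LinearIndependent F s} // Submodule.span F (Set.range s.1) = U} ≃
      {t : Fin k → U // LinearIndependent F t} where
  toFun s := ⟨fun i => ⟨s.1.1 i, s.2.le (Submodule.subset_span (Set.mem_range_self i))⟩,
    LinearIndependent.of_comp U.subtype s.1.2⟩
  invFun t := ⟨⟨U.subtype ∘ t.1, t.2.map' U.subtype U.ker_subtype⟩, by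
    apply Submodule.eq_of_le_of_finrank_eq
    · rw [Submodule.span_le]
      rintro _ ⟨i, rfl⟩
      exact (t.1 i).2
    · rw [finrank_span_eq_card (t.2.map' U.subtype U.ker_subtype), Fintype.card_fin, hU]⟩
  left_inv _ := rfl
  right_inv _ := rfl

theorem card_submodule_finrank_eq [FiniteDimensional F V] (k : ℕ) :
    Nat.card {U : Submodule F V // Module.finrank F U = k} =
      gaussBinomNat (Fintype.card F) (Module.finrank F V) k := by
  classical
  have : Finite V := Module.finite_of_finite F
  have : Fintype {U : Submodule F V // Module.finrank F U = k} := Fintype.ofFinite _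
  rcases lt_or_ge (Module.finrank F V) k with hk | hk
  · rw [gaussBinomNat_eq_zero_of_lt _ hk, Nat.card_eq_zero]
    refine Or.inl ⟨fun U => ?_⟩
    have := Submodule.finrank_le U.1
    have := U.2
    omega
  have hq : 1 < Fintype.card F := Fintype.one_lt_card
  have hcast {n : ℕ} (hn : k ≤ n) :
      ((∏ i : Fin k, (Fintype.card F ^ n - Fintype.card F ^ i.val) : ℕ) : ℤ) =
        ∏ i ∈ Finset.range k, ((Fintype.card F : ℤ) ^ n - (Fintype.card F : ℤ) ^ i) := by
    rw [Finset.prod_range, Nat.cast_prod]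
    refine Finset.prod_congr rfl fun i _ => ?_
    rw [Nat.cast_sub (Nat.pow_le_pow_right hq.le (i.2.le.trans hn))]
    push_cast
    rfl
  let f : {s : Fin k → V // LinearIndependent F s} →
      {U : Submodule F V // Module.finrank F U = k} :=
    fun s => ⟨Submodule.span F (Set.range s.1), by
      rw [finrank_span_eq_card s.2, Fintype.card_fin]⟩
  have hfiber (U : {U : Submodule F V // Module.finrank F U = k}) :
      Nat.card {s // f s = U} =
        ∏ i : Fin k, (Fintype.card F ^ k - Fintype.card F ^ i.val) := by
    have h := card_linearIndependent (K := F) (V := U.1) U.2.ge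
    rw [U.2] at h
    rw [← h]
    exact Nat.card_congr ((Equiv.subtypeEquivRight fun s => Subtype.ext_iff).trans
      (linearIndependentSpanEquiv U.1 U.2))
  have hcount : Nat.card {U : Submodule F V // Module.finrank F U = k} *
      ∏ i : Fin k, (Fintype.card F ^ k - Fintype.card F ^ i.val) =
      ∏ i : Fin k, (Fintype.card F ^ Module.finrank F V - Fintype.card F ^ i.val) := by
    rw [← card_linearIndependent hk, ← Nat.card_congr (Equiv.sigmaFiberEquiv f), Nat.card_sigma,
      Finset.sum_congr rfl fun U _ => hfiber U, Finset.sum_const, Nat.card_eq_fintype_card,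
      Finset.card_univ, smul_eq_mul]
  have hne : ∏ i ∈ Finset.range k, ((Fintype.card F : ℤ) ^ k - (Fintype.card F : ℤ) ^ i) ≠ 0 := by
    refine Finset.prod_ne_zero_iff.mpr fun i hi => sub_ne_zero.mpr (ne_of_gt ?_)
    exact pow_lt_pow_right₀ (by exact_mod_cast hq) (Finset.mem_range.mp hi)
  have hZ := congrArg (Nat.cast : ℕ → ℤ) hcount
  rw [Nat.cast_mul, hcast le_rfl, hcast hk, ← gaussBinomNat_mul_prod _ (Module.finrank F V)] at hZ
  exact_mod_cast mul_right_cancel₀ hne hZ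

theorem card_submodule_le_finrank_eq (A : Submodule F V) [FiniteDimensional F A] (r : ℕ) :
    Nat.card {R : Submodule F V // R ≤ A ∧ Module.finrank F R = r} =
      gaussBinomNat (Fintype.card F) (Module.finrank F A) r := by
  rw [← card_submodule_finrank_eq (V := A)]
  refine Nat.card_congr (Equiv.trans ?_ ((Submodule.MapSubtype.orderIso A).toEquiv.subtypeEquiv
    (q := fun R => Module.finrank F R.1 = r) fun R => ?_).symm)
  · exact (Equiv.subtypeSubtypeEquivSubtypeInter (fun R : Submodule F V => R ≤ A)
      fun R => Module.finrank F R = r).symm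
  · change _ ↔ Module.finrank F (Submodule.map A.subtype R) = r
    rw [Submodule.finrank_map_subtype_eq]

theorem finrank_comap_mkQ {F V : Type*} [Field F] [AddCommGroup V] [Module F V]
    [FiniteDimensional F V] (W : Submodule F V) (U : Submodule F (V ⧸ W)) :
    Module.finrank F (U.comap W.mkQ) = Module.finrank F U + Module.finrank F W := by
  have e := (Submodule.quotientQuotientEquivQuotient W (U.comap W.mkQ)
    (W.le_comap_mkQ U)).finrank_eq
  rw [Submodule.map_comap_eq_of_surjective W.mkQ_surjective] at e
  have h1 := Submodule.finrank_quotient_add_finrank U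
  have h2 := Submodule.finrank_quotient_add_finrank W
  have h3 := Submodule.finrank_quotient_add_finrank (U.comap W.mkQ)
  omega

theorem card_submodule_ge_finrank_eq [FiniteDimensional F V] (W : Submodule F V) (k : ℕ) :
    (Nat.card {U : Submodule F V // W ≤ U ∧ Module.finrank F U = k} : ℤ) =
      gaussBinom (Fintype.card F) ((Module.finrank F V : ℤ) - Module.finrank F W)
        ((k : ℤ) - Module.finrank F W) := by
  have hW := Submodule.finrank_quotient_add_finrank W
  rcases lt_or_ge k (Module.finrank F W) with hk | hk
  · rw [gaussBinom, if_neg (by omega), Nat.cast_eq_zero, Nat.card_eq_zero]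
    refine Or.inl ⟨fun U => ?_⟩
    have := Submodule.finrank_mono U.2.1
    have := U.2.2
    omega
  · rw [show (Module.finrank F V : ℤ) - Module.finrank F W = (Module.finrank F (V ⧸ W) : ℕ) by
      omega, show (k : ℤ) - Module.finrank F W = (k - Module.finrank F W : ℕ) by omega,
      gaussBinom_natCast, ← card_submodule_finrank_eq, Nat.cast_inj]
    refine Nat.card_congr (Equiv.trans ?_ ((Submodule.comapMkQRelIso W).toEquiv.subtypeEquiv
      (q := fun U => Module.finrank F U.1 = k) fun U => ?_).symm)
    · exact (Equiv.subtypeSubtypeEquivSubtypeInter (fun U : Submodule F V => W ≤ U)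
        fun U => Module.finrank F U = k).symm
    · change _ ↔ Module.finrank F (Submodule.comap W.mkQ U) = k
      rw [finrank_comap_mkQ]
      omega

open Classical in
/-- Double counting of the triples `(U, R, S)` with `R ≤ U ⊓ A` and `S ≤ U ⊓ A'`. -/
theorem sum_gaussBinomNat_finrank_inf [FiniteDimensional F V] [Fintype (Submodule F V)]
    {A A' : Submodule F V} (hdisj : A ⊓ A' = ⊥) (k r s : ℕ) :
    ∑ U ∈ Finset.univ.filter (fun U : Submodule F V => Module.finrank F U = k),
      ((gaussBinomNat (Fintype.card F) (Module.finrank F ↥(U ⊓ A)) r : ℤ) *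
        gaussBinomNat (Fintype.card F) (Module.finrank F ↥(U ⊓ A')) s) =
      (gaussBinomNat (Fintype.card F) (Module.finrank F A) r : ℤ) *
        gaussBinomNat (Fintype.card F) (Module.finrank F A') s *
        gaussBinom (Fintype.card F) ((Module.finrank F V : ℤ) - r - s) ((k : ℤ) - r - s) := by
  have hind (B : Submodule F V) (t : ℕ) :
      (gaussBinomNat (Fintype.card F) (Module.finrank F B) t : ℤ) =
        ∑ R : Submodule F V, if R ≤ B ∧ Module.finrank F R = t then 1 else 0 := by
    rw [← card_submodule_le_finrank_eq, Finset.sum_boole, Nat.card_eq_fintype_card,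
      Fintype.card_subtype]
  simp_rw [hind, Finset.sum_mul_sum, Finset.sum_mul]
  rw [Finset.sum_comm]
  refine Finset.sum_congr rfl fun R _ => ?_
  rw [Finset.sum_comm]
  refine Finset.sum_congr rfl fun S _ => ?_
  by_cases hR : R ≤ A ∧ Module.finrank F R = r
  swap
  · rw [if_neg hR, zero_mul, zero_mul]
    refine Finset.sum_eq_zero fun U _ => ?_
    rw [if_neg fun h => hR ⟨h.1.trans inf_le_right, h.2⟩, zero_mul]
  by_cases hS : S ≤ A' ∧ Module.finrank F S = s
  swap
  · rw [if_neg hS, mul_zero, zero_mul]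
    refine Finset.sum_eq_zero fun U _ => ?_
    rw [if_neg fun h : S ≤ U ⊓ A' ∧ Module.finrank F S = s => hS ⟨h.1.trans inf_le_right, h.2⟩,
      mul_zero]
  have hRS : Module.finrank F ↥(R ⊔ S) = r + s := by
    have h := Submodule.finrank_sup_add_finrank_inf_eq R S
    rwa [eq_bot_iff.mpr ((inf_le_inf hR.1 hS.1).trans hdisj.le), finrank_bot, add_zero, hR.2,
      hS.2] at h
  have hcount := card_submodule_ge_finrank_eq (R ⊔ S) k
  rw [hRS, Nat.cast_add, ← sub_sub, ← sub_sub, Nat.card_eq_fintype_card,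
    Fintype.card_subtype] at hcount
  rw [if_pos hR, if_pos hS, one_mul, one_mul, ← hcount, ← Finset.sum_boole, Finset.sum_filter]
  refine Finset.sum_congr rfl fun U _ => ?_
  simp only [le_inf_iff, hR.1, hR.2, hS.1, hS.2, and_true, sup_le_iff]
  split_ifs <;> simp_all

/-- The number of `k`-spaces meeting disjoint `m`-spaces `A`, `A'` in dimensions `l`, `l'`. -/
theorem card_submodule_finrank_inf_eq [FiniteDimensional F V] {A A' : Submodule F V} {m : ℕ}
    (hA : Module.finrank F A = m) (hA' : Module.finrank F A' = m) (hdisj : A ⊓ A' = ⊥) (k : ℕ)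
    {l l' : ℕ} (hl : l ≤ m) (hl' : l' ≤ m) :
    (Nat.card {U : Submodule F V // Module.finrank F U = k ∧ Module.finrank F ↥(U ⊓ A) = l ∧
      Module.finrank F ↥(U ⊓ A') = l'} : ℤ) =
      doubleCount (Fintype.card F) (Module.finrank F V) k m l l' := by
  classical
  have : Finite V := Module.finite_of_finite F
  have : Fintype (Submodule F V) := Fintype.ofFinite _
  have hq : 1 < Fintype.card F := Fintype.one_lt_card
  have hle {B : Submodule F V} (hB : Module.finrank F B = m) (U : Submodule F V) :
      Module.finrank F ↥(U ⊓ B) ≤ m := hB ▸ Submodule.finrank_mono inf_le_right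
  have hind (U : Submodule F V) :
      (if Module.finrank F ↥(U ⊓ A) = l ∧ Module.finrank F ↥(U ⊓ A') = l' then (1 : ℤ) else 0) =
      (if Module.finrank F ↥(U ⊓ A) = l then 1 else 0) *
        (if Module.finrank F ↥(U ⊓ A') = l' then 1 else 0) := by
    rw [ite_and, ite_zero_mul, one_mul]
  rw [Nat.card_eq_fintype_card, Fintype.card_subtype, ← Finset.filter_filter, ← Finset.sum_boole]
  simp_rw [hind, ← sum_Icc_gaussBinomNat_inversion hq (hle hA _) hl,
    ← sum_Icc_gaussBinomNat_inversion hq (hle hA' _) hl', Finset.sum_mul_sum]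
  rw [Finset.sum_comm, doubleCount, Finset.mul_sum]
  refine Finset.sum_congr rfl fun r hr => ?_
  rw [Finset.sum_comm, Finset.mul_sum]
  refine Finset.sum_congr rfl fun s hs => ?_
  rw [Finset.mem_Icc] at hr hs
  have hsum := sum_gaussBinomNat_finrank_inf hdisj k r s
  have h1 := gaussBinomNat_mul_gaussBinomNat hq hr.1 hr.2
  have h2 := gaussBinomNat_mul_gaussBinomNat hq hs.1 hs.2
  rw [hA, hA'] at hsum
  rw [gaussBinom_natCast, gaussBinom_natCast, ← Nat.cast_sub hl, ← Nat.cast_sub hl',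
    ← Nat.cast_sub hr.1, ← Nat.cast_sub hs.1, gaussBinom_natCast, gaussBinom_natCast,
    show r + s - l - l' = (r - l) + (s - l') by omega, pow_add, pow_add]
  set c := (-1 : ℤ) ^ (r - l) * (Fintype.card F : ℤ) ^ ((r - l) * (r - l - 1) / 2)
  set d := (-1 : ℤ) ^ (s - l') * (Fintype.card F : ℤ) ^ ((s - l') * (s - l' - 1) / 2)
  calc _ = c * d * gaussBinomNat (Fintype.card F) r l * gaussBinomNat (Fintype.card F) s l' *
        ∑ U ∈ Finset.univ.filter (fun U : Submodule F V => Module.finrank F U = k),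
          ((gaussBinomNat (Fintype.card F) (Module.finrank F ↥(U ⊓ A)) r : ℤ) *
            gaussBinomNat (Fintype.card F) (Module.finrank F ↥(U ⊓ A')) s) := by
        rw [Finset.mul_sum]
        exact Finset.sum_congr rfl fun U _ => by ring
    _ = c * d * gaussBinom (Fintype.card F) ((Module.finrank F V : ℤ) - r - s)
          ((k : ℤ) - r - s) *
        ((gaussBinomNat (Fintype.card F) m r : ℤ) * gaussBinomNat (Fintype.card F) r l) *
        ((gaussBinomNat (Fintype.card F) m s : ℤ) * gaussBinomNat (Fintype.card F) s l') := by
        rw [hsum]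
        ring
    _ = _ := by
        rw [h1, h2]
        ring

theorem card_submodule_le_finrank_inf [FiniteDimensional F V] {A A' : Submodule F V} {m : ℕ}
    (hA : Module.finrank F A = m) (hA' : Module.finrank F A' = m) (hdisj : A ⊓ A' = ⊥)
    (k h : ℕ) :
    (Nat.card {U : Submodule F V // Module.finrank F U = k ∧
      h + 1 ≤ Module.finrank F ↥(U ⊓ A) ∧ h + 1 ≤ Module.finrank F ↥(U ⊓ A')} : ℤ) =
      omegaCount (Fintype.card F) (Module.finrank F V) k m h := by
  classical
  have : Finite V := Module.finite_of_finite F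
  have : Fintype (Submodule F V) := Fintype.ofFinite _
  have hle {B : Submodule F V} (hB : Module.finrank F B = m) (U : Submodule F V) :
      Module.finrank F ↥(U ⊓ B) ≤ m := hB ▸ Submodule.finrank_mono inf_le_right
  rw [omegaCount, Finset.sum_congr rfl fun l hl => Finset.sum_congr rfl fun l' hl' =>
    (card_submodule_finrank_inf_eq hA hA' hdisj k (Finset.mem_Icc.mp hl).2
      (Finset.mem_Icc.mp hl').2).symm]
  rw [← Finset.sum_product', ← Nat.cast_sum, Nat.cast_inj]
  simp only [Nat.card_eq_fintype_card, Fintype.card_subtype]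
  rw [Finset.card_eq_sum_card_fiberwise
    (f := fun U => (Module.finrank F ↥(U ⊓ A), Module.finrank F ↥(U ⊓ A')))
    (t := Finset.Icc (h + 1) m ×ˢ Finset.Icc (h + 1) m)]
  · refine Finset.sum_congr rfl fun p hp => ?_
    congr 1
    ext U
    simp only [Finset.mem_product, Finset.mem_Icc] at hp
    simp only [Finset.mem_filter, Finset.mem_univ, true_and, Prod.ext_iff]
    constructor
    · rintro ⟨⟨h1, -⟩, h2⟩
      exact ⟨h1, h2⟩
    · rintro ⟨h1, h2, h3⟩
      exact ⟨⟨h1, h2 ▸ hp.1.1, h3 ▸ hp.2.1⟩, h2, h3⟩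
  · intro U hU
    have hU' := (Finset.mem_filter.mp hU).2
    exact Finset.mem_product.mpr ⟨Finset.mem_Icc.mpr ⟨hU'.2.1, hle hA U⟩,
      Finset.mem_Icc.mpr ⟨hU'.2.2, hle hA' U⟩⟩

end Counting

/-- For `1 ≤ k ≤ N`, `1 ≤ m ≤ N-k` and `A, A'` disjoint
`m`-dimensional subspaces of `F_q^N`: for all `1 ≤ l, l' ≤ m` the number of `k`-spaces
meeting `A` in dimension `l` and `A'` in dimension `l'` is given by the double-sum
formula, and for `1 ≤ h ≤ m-1` the number of `k`-spaces meeting both `A` and `A'` in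
dimension at least `h+1` equals `ω_q(N,k,m,h)`. -/
theorem stmt_10 (q N k m : ℕ) (hq : IsPrimePow q)
    (hk1 : 1 ≤ k) (hkN : k ≤ N) (hm1 : 1 ≤ m) (hm : m ≤ N - k)
    (F : Type) [Field F] [Fintype F] (hF : Fintype.card F = q)
    (A A' : Submodule F (Fin N → F))
    (hA : Module.finrank F A = m) (hA' : Module.finrank F A' = m)
    (hdisj : A ⊓ A' = ⊥) :
    (∀ l l' : ℕ, 1 ≤ l → l ≤ m → 1 ≤ l' → l' ≤ m →
      (Nat.card {U : Submodule F (Fin N → F) //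
          Module.finrank F U = k ∧ Module.finrank F ↥(U ⊓ A) = l ∧
            Module.finrank F ↥(U ⊓ A') = l'} : ℤ) = doubleCount q N k m l l') ∧
    (∀ h : ℕ, 1 ≤ h → h ≤ m - 1 →
      (Nat.card {U : Submodule F (Fin N → F) //
          Module.finrank F U = k ∧ h + 1 ≤ Module.finrank F ↥(U ⊓ A) ∧
            h + 1 ≤ Module.finrank F ↥(U ⊓ A')} : ℤ) = omegaCount q N k m h) := by
  subst hF
  have hN : Module.finrank F (Fin N → F) = N := Module.finrank_fin_fun F
  refine ⟨fun l l' _ hl _ hl' => ?_, fun h _ _ => ?_⟩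
  · rw [card_submodule_finrank_inf_eq hA hA' hdisj k hl hl', hN]
  · rw [card_submodule_le_finrank_inf hA hA' hdisj k h, hN]
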